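/- Let ν, μ ∈ ℂ with Re(μ + ν) > -1 and let x ∈ (-1,1). Then (1/Γ(ν - μ + 1)) · P_ν^{-μ}(x) = 2^{-μ} (1-x)^μ · (1/Γ(ν + μ + 1)) · ∑_{n=0}^∞ ((-2μ)_n (-ν)_n / n!) · ((1+x)/(1-x))^{n/2} · P_{ν-μ}^{μ-n}(x), the series converging absolutely. -/

import Mathlib

noncomputable def pochC (a : ℂ) (n : ℕ) : ℂ := (ascPochhammer ℂ n).eval a

/-- Ferrers function of the first kind `P_ν^μ(x)`. -/
noncomputable def ferrersP (ν μ : ℂ) (x : ℝ) : ℂ :=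
  (((1 + x) / (1 - x) : ℝ) : ℂ) ^ (μ / 2) *
    ∑' n : ℕ, pochC (-ν) n * pochC (ν + 1) n /
        (Complex.Gamma ((n : ℂ) + 1 - μ) * (n.factorial : ℂ)) *
      (((1 - x) / 2 : ℝ) : ℂ) ^ n

section HypergeometricSeries

open Filter Topology Asymptotics

lemma pochC_zero (a : ℂ) : pochC a 0 = 1 := by simp [pochC]

lemma pochC_succ (a : ℂ) (n : ℕ) : pochC a (n + 1) = pochC a n * (a + n) := by
  simp [pochC, ascPochhammer_succ_eval]

lemma pochC_succ_left (a : ℂ) (n : ℕ) : pochC a (n + 1) = a * pochC (a + 1) n := by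
  simp [pochC, ascPochhammer_succ_left, Polynomial.eval_comp]

lemma pochC_eq_prod (a : ℂ) (n : ℕ) : pochC a n = ∏ j ∈ Finset.range n, (a + j) := by
  induction n with
  | zero => simp [pochC_zero]
  | succ n ih => rw [pochC_succ, ih, Finset.prod_range_succ]

/-- `(a)_n / Γ(a + n) = 1 / Γ(a)`, valid also at the poles of `Γ`. -/
lemma pochC_mul_inv_Gamma (a : ℂ) (n : ℕ) :
    pochC a n * (Complex.Gamma (a + n))⁻¹ = (Complex.Gamma a)⁻¹ := by
  induction n with
  | zero => simp [pochC_zero]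
  | succ n ih =>
    rw [← ih, Complex.one_div_Gamma_eq_self_mul_one_div_Gamma_add_one (a + n), pochC_succ]
    push_cast
    rw [add_assoc a n 1]
    ring

lemma pochC_ne_zero_of_re_pos {a : ℂ} (ha : 0 < a.re) (n : ℕ) : pochC a n ≠ 0 := fun h0 => by
  have := pochC_mul_inv_Gamma a n
  rw [h0, zero_mul] at this
  exact inv_ne_zero (Complex.Gamma_ne_zero_of_re_pos ha) this.symm

lemma tendsto_pochC_div (s : ℂ) :
    Tendsto (fun n : ℕ => pochC s n / (n.factorial * (n : ℂ) ^ (s - 1))) atTop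
      (𝓝 (Complex.Gamma s)⁻¹) := by
  by_cases hs : Complex.Gamma s = 0
  · obtain ⟨m, rfl⟩ := (Complex.Gamma_eq_zero_iff s).1 hs
    rw [hs, inv_zero]
    refine tendsto_const_nhds.congr' ?_
    filter_upwards [eventually_gt_atTop m] with n hn
    rw [pochC_eq_prod, Finset.prod_eq_zero (Finset.mem_range.2 hn) (by simp), zero_div]
  · have h1 := ((Complex.GammaSeq_tendsto_Gamma s).inv₀ hs).mul
      (tendsto_natCast_div_add_atTop s)
    rw [mul_one] at h1
    refine h1.congr' ?_
    have h2 : ∀ᶠ n : ℕ in atTop, (n : ℂ) + s ≠ 0 := by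
      filter_upwards [eventually_gt_atTop ⌈-s.re⌉₊] with n hn h
      have : -s.re < n := (Nat.le_ceil _).trans_lt (by exact_mod_cast hn)
      have h' := congrArg Complex.re h
      simp at h'
      linarith
    filter_upwards [eventually_gt_atTop 0, h2] with n hn h2
    have hn0 : (n : ℂ) ≠ 0 := by exact_mod_cast hn.ne'
    have hf : (n.factorial : ℂ) ≠ 0 := by exact_mod_cast n.factorial_ne_zero
    have hp : (n : ℂ) ^ s ≠ 0 := by simp [Complex.cpow_eq_zero_iff, hn0]
    rw [Complex.GammaSeq, ← pochC_eq_prod, pochC_succ, Complex.cpow_sub _ _ hn0, Complex.cpow_one,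
      add_comm s]
    field_simp

lemma tendsto_inv_Gamma_add_mul {c : ℂ} (hc : 0 < c.re) :
    Tendsto (fun n : ℕ => (Complex.Gamma (c + n))⁻¹ * (n.factorial * (n : ℂ) ^ (c - 1))) atTop
      (𝓝 1) := by
  have hG := inv_ne_zero (Complex.Gamma_ne_zero_of_re_pos hc)
  have h1 := ((tendsto_pochC_div c).inv₀ hG).const_mul (Complex.Gamma c)⁻¹
  rw [mul_inv_cancel₀ hG] at h1
  refine h1.congr fun n => ?_
  rw [← pochC_mul_inv_Gamma c n, inv_div]
  have := pochC_ne_zero_of_re_pos hc n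
  field_simp

lemma norm_factorial_mul_cpow {n : ℕ} (hn : 0 < n) (s : ℂ) :
    ‖(n.factorial : ℂ) * (n : ℂ) ^ (s - 1)‖ = n.factorial * (n : ℝ) ^ (s.re - 1) := by
  rw [norm_mul, Complex.norm_natCast, Complex.norm_natCast_cpow_of_pos hn]
  simp

lemma isBigO_of_mul_isBigO_one {f g : ℕ → ℂ} {w : ℕ → ℝ}
    (h : (fun n => f n * g n) =O[atTop] fun _ => (1 : ℝ))
    (hg : ∀ᶠ n in atTop, ‖g n‖ * w n = 1) : f =O[atTop] w := by
  obtain ⟨C, hC⟩ := h.bound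
  refine IsBigO.of_bound C ?_
  filter_upwards [hC, hg] with n h1 h2
  rw [norm_one, mul_one, norm_mul] at h1
  calc ‖f n‖ = ‖f n‖ * ‖g n‖ * ‖w n‖ := by
        rw [mul_assoc, ← norm_norm (g n), ← norm_mul, h2, norm_one, mul_one]
    _ ≤ C * ‖w n‖ := by gcongr

lemma pochC_isBigO (s : ℂ) :
    (fun n : ℕ => pochC s n) =O[atTop] fun n : ℕ => n.factorial * (n : ℝ) ^ (s.re - 1) := by
  refine isBigO_of_mul_isBigO_one ((tendsto_pochC_div s).isBigO_one ℝ) ?_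
  filter_upwards [eventually_gt_atTop 0] with n hn
  rw [norm_inv, norm_factorial_mul_cpow hn]
  have : (0 : ℝ) < n := by exact_mod_cast hn
  exact inv_mul_cancel₀ (by positivity)

lemma inv_Gamma_add_isBigO (c : ℂ) :
    (fun n : ℕ => (Complex.Gamma (c + n))⁻¹) =O[atTop]
      fun n : ℕ => (n.factorial : ℝ)⁻¹ * (n : ℝ) ^ (1 - c.re) := by
  obtain ⟨k, hk⟩ := exists_nat_gt (-c.re)
  induction k generalizing c with
  | zero =>
    have hc : 0 < c.re := by simpa using hk
    refine isBigO_of_mul_isBigO_one ((tendsto_inv_Gamma_add_mul hc).isBigO_one ℝ) ?_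
    filter_upwards [eventually_gt_atTop 0] with n hn
    have : (0 : ℝ) < n := by exact_mod_cast hn
    rw [norm_factorial_mul_cpow hn, ← neg_sub c.re 1, Real.rpow_neg this.le, ← mul_inv]
    exact mul_inv_cancel₀ (by positivity)
  | succ k ih =>
    have h1 := ih (c + 1) (by push_cast at hk; simp; linarith)
    have h2 : (fun n : ℕ => c + n) =O[atTop] fun n : ℕ => (n : ℝ) := by
      refine IsBigO.of_bound (‖c‖ + 1) ?_
      filter_upwards [eventually_gt_atTop 0] with n hn
      have h1 : (1 : ℝ) ≤ n := by exact_mod_cast hn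
      refine (norm_add_le _ _).trans ?_
      simp only [Complex.norm_natCast, Real.norm_natCast]
      nlinarith [norm_nonneg c]
    refine (h2.mul h1).congr' ?_ ?_
    · filter_upwards with n
      rw [Complex.one_div_Gamma_eq_self_mul_one_div_Gamma_add_one (c + n)]
      ring_nf
    · filter_upwards [eventually_gt_atTop 0] with n hn
      have hn0 : (0 : ℝ) < n := by exact_mod_cast hn
      rw [show 1 - c.re = 1 + (1 - (c + 1).re) by simp; ring, Real.rpow_add hn0, Real.rpow_one]
      ring

/-- The `n`-th coefficient of the regularized Gauss hypergeometric series. -/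
noncomputable def hypTerm (a b c : ℂ) (n : ℕ) : ℂ :=
  pochC a n * pochC b n / n.factorial * (Complex.Gamma (c + n))⁻¹

lemma hypTerm_isBigO (a b c : ℂ) :
    hypTerm a b c =O[atTop] fun n : ℕ => (n : ℝ) ^ ((a + b - c).re - 1) := by
  have hf : (fun n : ℕ => ((n.factorial : ℂ))⁻¹) =O[atTop] fun n : ℕ => ((n.factorial : ℝ))⁻¹ :=
    IsBigO.of_bound 1 (by simp)
  refine ((((pochC_isBigO a).mul (pochC_isBigO b)).mul hf).mul
    (inv_Gamma_add_isBigO c)).congr' ?_ ?_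
  · exact Eventually.of_forall fun n => by simp [hypTerm, div_eq_mul_inv]
  · filter_upwards [eventually_gt_atTop 0] with n hn
    have hn0 : (0 : ℝ) < n := by exact_mod_cast hn
    rw [show (a + b - c).re - 1 = (a.re - 1) + (b.re - 1) + (1 - c.re) by simp; ring,
      Real.rpow_add hn0, Real.rpow_add hn0]
    have : (n.factorial : ℝ) ≠ 0 := by positivity
    field_simp

lemma summable_norm_hypTerm {a b c : ℂ} (h : 0 < (c - a - b).re) :
    Summable fun n => ‖hypTerm a b c n‖ :=
  summable_of_isBigO_nat (Real.summable_nat_rpow.2 (by simp at h ⊢; linarith))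
    (hypTerm_isBigO a b c).norm_left

lemma summable_norm_hypTerm_mul_pow (a b c : ℂ) {t : ℂ} (ht : ‖t‖ < 1) :
    Summable fun n => ‖hypTerm a b c n * t ^ n‖ := by
  obtain ⟨k, hk⟩ := exists_nat_gt ((a + b - c).re - 1)
  refine summable_of_isBigO_nat
    (summable_pow_mul_geometric_of_norm_lt_one k (r := ‖t‖) (by simpa using ht)) ?_
  have h1 : (fun n : ℕ => t ^ n) =O[atTop] fun n : ℕ => ‖t‖ ^ n := IsBigO.of_bound 1 (by simp)
  have h2 : (fun n : ℕ => (n : ℝ) ^ ((a + b - c).re - 1)) =O[atTop] fun n : ℕ => (n : ℝ) ^ k := by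
    refine IsBigO.of_bound 1 ?_
    filter_upwards [eventually_gt_atTop 0] with n hn
    have hn0 : (1 : ℝ) ≤ n := by exact_mod_cast hn
    rw [← Real.rpow_natCast, one_mul, Real.norm_of_nonneg (by positivity),
      Real.norm_of_nonneg (by positivity)]
    exact Real.rpow_le_rpow_of_exponent_le hn0 hk.le
  exact (((hypTerm_isBigO a b c).trans h2).mul h1).norm_left

/-- Contiguous relation behind Gauss's summation theorem, in telescoping form. -/
lemma hypTerm_telescope (a b c : ℂ) (n : ℕ) :
    (c - a) * (c - b) * hypTerm a b (c + 1) n - (c - a - b) * hypTerm a b c n =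
      (n + 1 : ℕ) * hypTerm a b c (n + 1) - n * hypTerm a b c n := by
  have hf : (n.factorial : ℂ) ≠ 0 := by exact_mod_cast n.factorial_ne_zero
  have hn : (n + 1 : ℂ) ≠ 0 := by exact_mod_cast n.succ_ne_zero
  simp only [hypTerm, pochC_succ, Nat.factorial_succ]
  rw [Complex.one_div_Gamma_eq_self_mul_one_div_Gamma_add_one (c + n),
    show c + 1 + n = c + n + 1 by ring]
  push_cast
  rw [← add_assoc c n 1]
  field_simp
  ring

lemma tsum_hypTerm_add_one {a b c : ℂ} (h : 0 < (c - a - b).re) :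
    (c - a - b) * ∑' n, hypTerm a b c n = (c - a) * (c - b) * ∑' n, hypTerm a b (c + 1) n := by
  have h0 := (summable_norm_hypTerm h).of_norm
  have h1 : Summable (hypTerm a b (c + 1)) :=
    (summable_norm_hypTerm (by simp at h ⊢; linarith)).of_norm
  have hG : Tendsto (fun n : ℕ => (n : ℂ) * hypTerm a b c n) atTop (𝓝 0) := by
    have hO : (fun n : ℕ => (n : ℂ) * hypTerm a b c n) =O[atTop]
        fun n : ℕ => (n : ℝ) ^ (-(c - a - b).re) := by
      have hn : (fun n : ℕ => (n : ℂ)) =O[atTop] fun n : ℕ => (n : ℝ) := IsBigO.of_bound 1 (by simp)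
      refine (hn.mul (hypTerm_isBigO a b c)).congr' EventuallyEq.rfl ?_
      filter_upwards [eventually_gt_atTop 0] with n hn
      have hn0 : (0 : ℝ) < n := by exact_mod_cast hn
      rw [show -(c - a - b).re = 1 + ((a + b - c).re - 1) by simp; ring, Real.rpow_add hn0,
        Real.rpow_one]
    exact hO.trans_tendsto ((tendsto_rpow_neg_atTop h).comp tendsto_natCast_atTop_atTop)
  have hs := (h1.hasSum.mul_left ((c - a) * (c - b))).sub (h0.hasSum.mul_left (c - a - b))
  simp only [hypTerm_telescope] at hs
  have hl := hs.tendsto_sum_nat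
  simp only [Finset.sum_range_sub (fun n : ℕ => (n : ℂ) * hypTerm a b c n)] at hl
  have := tendsto_nhds_unique hl (hG.sub_const _)
  simp only [Nat.cast_zero, zero_mul, sub_zero] at this
  linear_combination -this

lemma pochC_mul_tsum_hypTerm {a b c : ℂ} (h : 0 < (c - a - b).re) (m : ℕ) :
    pochC (c - a - b) m * ∑' n, hypTerm a b c n =
      pochC (c - a) m * pochC (c - b) m * ∑' n, hypTerm a b (c + m) n := by
  induction m with
  | zero => simp [pochC_zero]
  | succ m ih =>
    have := tsum_hypTerm_add_one (a := a) (b := b) (c := c + m)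
      (by simp at h ⊢; linarith [(Nat.cast_nonneg m : (0 : ℝ) ≤ m)])
    rw [show c + (m + 1 : ℕ) = c + m + 1 by push_cast; ring]
    simp only [pochC_succ]
    linear_combination (c - a - b + m) * ih + pochC (c - a) m * pochC (c - b) m * this

lemma norm_Gamma_div_Gamma_add_le {r : ℝ} (hr : 0 < r) {z : ℂ} (hz : r ≤ z.re) (n : ℕ) :
    ‖Complex.Gamma z * (Complex.Gamma (z + n))⁻¹‖ ≤
      ‖Complex.Gamma r * (Complex.Gamma (r + n))⁻¹‖ := by
  have key : ∀ w : ℂ, r ≤ w.re → Complex.Gamma w * (Complex.Gamma (w + n))⁻¹ = (pochC w n)⁻¹ := by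
    intro w hw
    have h1 := pochC_mul_inv_Gamma w n
    have h2 := Complex.Gamma_ne_zero_of_re_pos (hr.trans_le hw)
    refine eq_inv_of_mul_eq_one_left ?_
    rw [mul_assoc, mul_comm _ (pochC w n), h1, mul_inv_cancel₀ h2]
  rw [key z hz, key r (by simp), norm_inv, norm_inv]
  refine inv_anti₀ (norm_pos_iff.2 (pochC_ne_zero_of_re_pos (by simpa using hr) n)) ?_
  rw [pochC_eq_prod, pochC_eq_prod, norm_prod, norm_prod]
  refine Finset.prod_le_prod (fun _ _ => norm_nonneg _) fun j _ => ?_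
  have : ‖(r : ℂ) + j‖ = r + j := by
    rw [← Complex.ofReal_natCast, ← Complex.ofReal_add, Complex.norm_real,
      Real.norm_of_nonneg (by positivity)]
  rw [this]
  refine le_trans ?_ (Complex.re_le_norm _)
  simpa using hz

lemma tendsto_Gamma_div_Gamma_add (c : ℂ) (n : ℕ) :
    Tendsto (fun m : ℕ => Complex.Gamma (c + m) * (Complex.Gamma (c + m + n))⁻¹) atTop
      (𝓝 (if n = 0 then 1 else 0)) := by
  have hre : ∀ᶠ m : ℕ in atTop, 0 < (c + m).re := by
    filter_upwards [eventually_gt_atTop ⌈-c.re⌉₊] with m hm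
    have : -c.re < m := (Nat.le_ceil _).trans_lt (by exact_mod_cast hm)
    simp
    linarith
  induction n with
  | zero =>
    refine tendsto_const_nhds.congr' ?_
    filter_upwards [hre] with m hm
    simp [mul_inv_cancel₀ (Complex.Gamma_ne_zero_of_re_pos hm)]
  | succ n ih =>
    have h1 : Tendsto (fun m : ℕ => (c + m + n)⁻¹) atTop (𝓝 0) := by
      have : Tendsto (fun m : ℕ => (c + n) + (m : ℂ)) atTop (Bornology.cobounded ℂ) :=
        (tendsto_const_add_cobounded _).comp (tendsto_norm_atTop_iff_cobounded.1
          (by simpa using tendsto_natCast_atTop_atTop (R := ℝ)))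
      refine (tendsto_inv₀_cobounded.comp this).congr fun m => ?_
      simp only [Function.comp]
      ring_nf
    have h2 := ih.mul h1
    rw [mul_zero] at h2
    simp only [Nat.add_eq_zero_iff, one_ne_zero, and_false, if_false]
    refine h2.congr' ?_
    filter_upwards [hre] with m hm
    have h3 : c + m + n ≠ 0 := fun h => by
      have := congrArg Complex.re h
      simp at this hm
      linarith [(Nat.cast_nonneg n : (0 : ℝ) ≤ n)]
    rw [Complex.one_div_Gamma_eq_self_mul_one_div_Gamma_add_one (c + m + n)]
    push_cast
    rw [← add_assoc (c + m) (n : ℂ) 1]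
    field_simp

lemma tendsto_Gamma_mul_tsum_hypTerm (a b c : ℂ) :
    Tendsto (fun m : ℕ => Complex.Gamma (c + m) * ∑' n, hypTerm a b (c + m) n) atTop (𝓝 1) := by
  obtain ⟨M, hM⟩ := exists_nat_gt (max (-c.re) ((a + b - c).re))
  have hM1 := (le_max_left _ _).trans_lt hM
  have hM2 := (le_max_right _ _).trans_lt hM
  set r : ℝ := c.re + M with hr
  have hr0 : 0 < r := by linarith
  have hsum := (summable_norm_hypTerm (a := a) (b := b) (c := r)
    (by simp at hM2 ⊢; linarith)).mul_left ‖Complex.Gamma r‖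
  have hlim : ∑' n : ℕ, (pochC a n * pochC b n / n.factorial * if n = 0 then 1 else 0) = 1 := by
    rw [tsum_eq_single 0 (fun n hn => by simp [hn])]
    simp [pochC_zero]
  rw [← hlim]
  simp only [← tsum_mul_left]
  refine tendsto_tsum_of_dominated_convergence hsum (fun n => ?_) ?_
  · refine ((tendsto_Gamma_div_Gamma_add c n).const_mul _).congr fun m => ?_
    rw [hypTerm]
    ring
  · filter_upwards [eventually_ge_atTop M] with m hm n
    have hm' : (M : ℝ) ≤ m := by exact_mod_cast hm
    have := norm_Gamma_div_Gamma_add_le hr0 (z := c + m) (by simp [hr]; exact hm) n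
    rw [← norm_mul]
    calc _ = ‖pochC a n * pochC b n / n.factorial‖ *
          ‖Complex.Gamma (c + m) * (Complex.Gamma (c + m + n))⁻¹‖ := by
            rw [← norm_mul, hypTerm]; ring_nf
      _ ≤ ‖pochC a n * pochC b n / n.factorial‖ *
          ‖Complex.Gamma r * (Complex.Gamma (r + n))⁻¹‖ := by gcongr
      _ = _ := by rw [← norm_mul, hypTerm]; ring_nf

lemma tsum_hypTerm_of_re_pos {a b c : ℂ} (hc : 0 < c.re) (h : 0 < (c - a - b).re) :
    (Complex.Gamma (c - a - b))⁻¹ * ∑' n, hypTerm a b c n =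
      (Complex.Gamma (c - a))⁻¹ * (Complex.Gamma (c - b))⁻¹ := by
  have hL := (tendsto_pochC_div (c - a - b)).mul_const (∑' n, hypTerm a b c n)
  have hR := ((tendsto_pochC_div (c - a)).mul (tendsto_pochC_div (c - b))).mul
    ((tendsto_inv_Gamma_add_mul hc).mul (tendsto_Gamma_mul_tsum_hypTerm a b c))
  rw [mul_one, mul_one] at hR
  refine tendsto_nhds_unique hL (hR.congr' ?_)
  filter_upwards [eventually_gt_atTop 0] with m hm
  have hm0 : (m : ℂ) ≠ 0 := by exact_mod_cast hm.ne'
  have hf : (m.factorial : ℂ) ≠ 0 := by exact_mod_cast m.factorial_ne_zero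
  have hp : ∀ s : ℂ, (m : ℂ) ^ s ≠ 0 := fun s => by simp [Complex.cpow_eq_zero_iff, hm0]
  have hG : Complex.Gamma (c + m) ≠ 0 := Complex.Gamma_ne_zero_of_re_pos (by simp; positivity)
  have he : (m : ℂ) ^ (c - a - 1) * (m : ℂ) ^ (c - b - 1) =
      (m : ℂ) ^ (c - a - b - 1) * (m : ℂ) ^ (c - 1) := by
    rw [← Complex.cpow_add _ _ hm0, ← Complex.cpow_add _ _ hm0]
    ring_nf
  have key := pochC_mul_tsum_hypTerm h m
  have h1 := hp (c - a - 1)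
  have h2 := hp (c - b - 1)
  have h3 := hp (c - a - b - 1)
  rw [div_mul_eq_mul_div (pochC (c - a - b) m), key]
  field_simp
  linear_combination (-(pochC (c - a) m * pochC (c - b) m * ∑' n, hypTerm a b (c + m) n)) * he

/-- Gauss's summation theorem for the regularized hypergeometric series. -/
theorem tsum_hypTerm {a b c : ℂ} (h : 0 < (c - a - b).re) :
    ∑' n, hypTerm a b c n =
      Complex.Gamma (c - a - b) * (Complex.Gamma (c - a))⁻¹ * (Complex.Gamma (c - b))⁻¹ := by
  suffices H : (Complex.Gamma (c - a - b))⁻¹ * ∑' n, hypTerm a b c n =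
      (Complex.Gamma (c - a))⁻¹ * (Complex.Gamma (c - b))⁻¹ by
    rw [mul_assoc, ← H, mul_inv_cancel_left₀ (Complex.Gamma_ne_zero_of_re_pos h)]
  obtain ⟨k, hk⟩ := exists_nat_gt (-c.re)
  have h1 := tsum_hypTerm_of_re_pos (a := a) (b := b) (c := c + k) (by simp; linarith)
    (by simp at h ⊢; linarith [(Nat.cast_nonneg k : (0 : ℝ) ≤ k)])
  rw [← pochC_mul_inv_Gamma (c - a - b) k, ← pochC_mul_inv_Gamma (c - a) k,
    ← pochC_mul_inv_Gamma (c - b) k, mul_right_comm, pochC_mul_tsum_hypTerm h k]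
  rw [show c - a + k = c + k - a by ring, show c - b + k = c + k - b by ring,
    show c - a - b + k = c + k - a - b by ring]
  linear_combination pochC (c - a) k * pochC (c - b) k * h1

lemma hasSum_binomial (μ : ℂ) {t : ℂ} (ht : ‖t‖ < 1) :
    HasSum (fun n : ℕ => pochC μ n / n.factorial * t ^ n) (1 / (1 - t) ^ μ) := by
  have h := (Complex.one_div_one_sub_cpow_hasFPowerSeriesOnBall_zero μ).hasSum (y := t)
    (mem_eball_zero_iff.2 (by simpa [enorm, ← NNReal.coe_lt_coe] using ht))
  rw [zero_add] at h
  refine h.congr_fun fun n => ?_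
  have hf : (n.factorial : ℂ) ≠ 0 := by exact_mod_cast n.factorial_ne_zero
  rw [FormalMultilinearSeries.ofScalars_apply_eq, smul_eq_mul, ← Ring.multichoose_eq, pochC,
    ← Polynomial.ascPochhammer_smeval_eq_eval, ← Ring.factorial_nsmul_multichoose_eq_ascPochhammer,
    nsmul_eq_mul, mul_div_cancel_left₀ _ hf]

lemma sum_choose_mul_pochC (ν μ : ℂ) (n : ℕ) :
    ∑ k ∈ Finset.range (n + 1), (n.choose k : ℂ) * pochC μ (n - k) * pochC (1 + μ + k) (n - k) *
        (pochC (-ν) k * pochC (ν + 1) k) =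
      pochC (μ - ν) n * pochC (1 + μ + ν) n := by
  induction n with
  | zero => simp [pochC_zero]
  | succ n ih =>
    rw [pochC_succ, pochC_succ, show pochC (μ - ν) n * (μ - ν + n) *
      (pochC (1 + μ + ν) n * (1 + μ + ν + n)) = (pochC (μ - ν) n * pochC (1 + μ + ν) n) *
      ((μ - ν + n) * (1 + μ + ν + n)) by ring, ← ih, Finset.sum_mul]
    set C : ℕ → ℂ := fun k => (n.choose k : ℂ) * pochC μ (n - k) * pochC (1 + μ + k) (n - k)
      with hC
    set e : ℕ → ℂ := fun k => pochC (-ν) k * pochC (ν + 1) k with he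
    have hsplit : ∀ k, C k * e k * ((μ - ν + n) * (1 + μ + ν + n)) =
        C k * ((μ + n - k) * (μ + n + k + 1)) * e k + C k * e (k + 1) := by
      intro k
      simp only [he, pochC_succ]
      ring
    rw [Finset.sum_congr rfl fun k _ => hsplit k, Finset.sum_add_distrib, Finset.sum_range_succ']
    rw [Finset.sum_range_succ' (n := n) (f := fun k => C k * ((μ + n - k) * (μ + n + k + 1)) * e k)]
    have hext : ∑ k ∈ Finset.range n, C (k + 1) * ((μ + n - (k + 1 : ℕ)) *
        (μ + n + (k + 1 : ℕ) + 1)) * e (k + 1) = ∑ k ∈ Finset.range (n + 1), C (k + 1) *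
        ((μ + n - (k + 1 : ℕ)) * (μ + n + (k + 1 : ℕ) + 1)) * e (k + 1) := by
      rw [Finset.sum_range_succ]
      simp [hC]
    rw [hext, add_right_comm (Finset.sum _ _) _ (Finset.sum _ _), ← Finset.sum_add_distrib]
    congr 1
    · refine Finset.sum_congr rfl fun k hk => ?_
      have hk' : k ≤ n := Nat.lt_succ_iff.1 (Finset.mem_range.1 hk)
      rw [← add_mul]
      congr 1
      simp only [hC]
      obtain ⟨m, rfl⟩ := Nat.exists_eq_add_of_le hk'
      rw [show k + m + 1 - (k + 1) = m by omega, show k + m - k = m by omega]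
      rcases m with _ | m
      · simp [pochC_zero]
      · rw [show k + (m + 1) - (k + 1) = m by omega]
        have hch : (((k + (m + 1)).choose (k + 1) : ℕ) : ℂ) * (k + 1) =
            ((k + (m + 1)).choose k : ℕ) * (m + 1) := by
          have := Nat.choose_succ_right_eq (k + (m + 1)) k
          rw [show k + (m + 1) - k = m + 1 by omega] at this
          exact_mod_cast this
        rw [Nat.choose_succ_succ, pochC_succ_left (1 + μ + k) m, pochC_succ μ m,
          pochC_succ (1 + μ + (k + 1 : ℕ)) m]
        push_cast
        rw [show 1 + μ + (k : ℂ) + 1 = 1 + μ + (k + 1) by ring]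
        linear_combination pochC μ m * pochC (1 + μ + (k + 1)) m * (μ + m) * (-1) * hch
    · simp [hC, pochC_succ, pochC_zero, he]
      ring

lemma sum_antidiagonal_hypTerm (ν μ : ℂ) (n : ℕ) :
    ∑ p ∈ Finset.HasAntidiagonal.antidiagonal n, hypTerm (-ν) (ν + 1) (1 + μ) p.1 *
        (pochC μ p.2 / p.2.factorial) =
      hypTerm (μ - ν) (1 + μ + ν) (1 + μ) n := by
  rw [Finset.Nat.sum_antidiagonal_eq_sum_range_succ (fun k j => hypTerm (-ν) (ν + 1) (1 + μ) k *
        (pochC μ j / j.factorial)), hypTerm, ← sum_choose_mul_pochC, Finset.sum_div, Finset.sum_mul]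
  refine Finset.sum_congr rfl fun k hk => ?_
  obtain ⟨m, rfl⟩ := Nat.exists_eq_add_of_le (Nat.lt_succ_iff.1 (Finset.mem_range.1 hk))
  rw [show k + m - k = m by omega, hypTerm, ← pochC_mul_inv_Gamma (1 + μ + k) m,
    Nat.cast_choose ℂ (Nat.le_add_right k m), show k + m - k = m by omega]
  have h1 : ((k + m).factorial : ℂ) ≠ 0 := by exact_mod_cast (k + m).factorial_ne_zero
  push_cast
  rw [← add_assoc]
  field_simp

/-- Euler's transformation for the hypergeometric series of Legendre type. -/
lemma tsum_hypTerm_euler (ν μ : ℂ) {t : ℂ} (ht : ‖t‖ < 1) :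
    ∑' n, hypTerm (μ - ν) (1 + μ + ν) (1 + μ) n * t ^ n =
      (∑' n, hypTerm (-ν) (ν + 1) (1 + μ) n * t ^ n) * (1 / (1 - t) ^ μ) := by
  have hb := hasSum_binomial μ ht
  rw [← hb.tsum_eq, tsum_mul_tsum_eq_tsum_sum_antidiagonal_of_summable_norm
    (summable_norm_hypTerm_mul_pow _ _ _ ht) hb.summable.norm]
  refine tsum_congr fun n => ?_
  rw [← sum_antidiagonal_hypTerm, Finset.sum_mul]
  refine Finset.sum_congr rfl fun p hp => ?_
  rw [← Finset.HasAntidiagonal.mem_antidiagonal.1 hp, pow_add]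
  ring

lemma summable_double_hyp {a b c : ℂ} (a' b' : ℂ) {t : ℂ} (h : 0 < (c - a - b).re)
    (ht : ‖t‖ < 1) :
    Summable fun p : ℕ × ℕ => pochC a p.1 * pochC b p.1 / p.1.factorial *
      (hypTerm a' b' (c + p.1) p.2 * t ^ p.2) := by
  refine Summable.of_norm ((summable_prod_of_nonneg fun _ => norm_nonneg _).2 ⟨fun n => ?_, ?_⟩)
  · simpa only [norm_mul] using ((summable_norm_hypTerm_mul_pow a' b' (c + n) ht).mul_left
      ‖pochC a n * pochC b n / n.factorial‖)
  · refine summable_of_isBigO_nat ((summable_norm_hypTerm h).mul_right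
      (∑' k, ‖hypTerm a' b' 1 k * t ^ k‖)) (IsBigO.of_bound 1 ?_)
    obtain ⟨N, hN⟩ := exists_nat_gt (1 - c.re)
    filter_upwards [eventually_ge_atTop N] with n hn
    have hn' : (N : ℝ) ≤ n := by exact_mod_cast hn
    have hre : 1 ≤ (c + n).re := by simp; linarith
    rw [Real.norm_of_nonneg (tsum_nonneg fun _ => norm_nonneg _), one_mul,
      Real.norm_of_nonneg (mul_nonneg (norm_nonneg _) (tsum_nonneg fun _ => norm_nonneg _)),
      ← tsum_mul_left]
    refine Summable.tsum_le_tsum (fun k => ?_) ?_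
      ((summable_norm_hypTerm_mul_pow a' b' 1 ht).mul_left _)
    · have hG := norm_Gamma_div_Gamma_add_le one_pos hre k
      have hne := Complex.Gamma_ne_zero_of_re_pos (one_pos.trans_le hre)
      rw [Complex.ofReal_one, Complex.Gamma_one, one_mul] at hG
      calc _ = ‖hypTerm a b c n‖ * ‖pochC a' k * pochC b' k / k.factorial * t ^ k‖ *
              ‖Complex.Gamma (c + n) * (Complex.Gamma (c + n + k))⁻¹‖ := by
            rw [← norm_mul, ← norm_mul, hypTerm, hypTerm]
            congr 1
            field_simp
        _ ≤ ‖hypTerm a b c n‖ * ‖pochC a' k * pochC b' k / k.factorial * t ^ k‖ *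
              ‖(Complex.Gamma (1 + k))⁻¹‖ := by gcongr
        _ = _ := by
            rw [mul_assoc, ← norm_mul]
            simp only [hypTerm]
            ring_nf
    · simpa only [norm_mul] using ((summable_norm_hypTerm_mul_pow a' b' (c + n) ht).mul_left
        ‖pochC a n * pochC b n / n.factorial‖)

lemma ferrersP_eq_hypTerm (ν μ : ℂ) (x : ℝ) :
    ferrersP ν μ x = (((1 + x) / (1 - x) : ℝ) : ℂ) ^ (μ / 2) *
      ∑' n, hypTerm (-ν) (ν + 1) (1 - μ) n * (((1 - x) / 2 : ℝ) : ℂ) ^ n := by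
  rw [ferrersP]
  congr 1
  refine tsum_congr fun n => ?_
  rw [hypTerm, show (n : ℂ) + 1 - μ = 1 - μ + n by ring]
  ring

lemma ferrers_prefactor {x : ℝ} (hx : -1 < x) (hx1 : x < 1) (μ : ℂ) :
    (((1 + x) / (1 - x) : ℝ) : ℂ) ^ (-μ / 2) =
      (2 : ℂ) ^ (-μ) * ((1 - x : ℝ) : ℂ) ^ μ * (((1 + x) / (1 - x) : ℝ) : ℂ) ^ (μ / 2) *
        (1 / (1 - (((1 - x) / 2 : ℝ) : ℂ)) ^ μ) := by
  have hm : 0 < 1 - x := by linarith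
  have hp : 0 < (1 + x) / 2 := by linarith
  set y : ℝ := (1 + x) / (1 - x) with hy
  have hy0 : 0 < y := div_pos (by linarith) hm
  have hyC : (y : ℂ) ≠ 0 := by exact_mod_cast hy0.ne'
  have hpC : ((((1 + x) / 2 : ℝ)) : ℂ) ≠ 0 := by exact_mod_cast hp.ne'
  have e1 : 1 - (((1 - x) / 2 : ℝ) : ℂ) = (((1 + x) / 2 : ℝ) : ℂ) := by push_cast; ring
  have e2 : (((1 - x : ℝ)) : ℂ) ^ μ * (y : ℂ) ^ μ = (2 : ℂ) ^ μ * (((1 + x) / 2 : ℝ) : ℂ) ^ μ := by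
    rw [← Complex.mul_cpow_ofReal_nonneg hm.le hy0.le, ← Complex.ofReal_ofNat,
      ← Complex.mul_cpow_ofReal_nonneg zero_le_two hp.le, ← Complex.ofReal_mul,
      ← Complex.ofReal_mul]
    congr 2
    rw [hy]
    field_simp
  have e3 : (y : ℂ) ^ μ = (y : ℂ) ^ (μ / 2) * (y : ℂ) ^ (μ / 2) := by
    rw [← Complex.cpow_add _ _ hyC, add_halves]
  have h1 : (y : ℂ) ^ (μ / 2) ≠ 0 := by simp [Complex.cpow_eq_zero_iff, hyC]
  have h2 : (2 : ℂ) ^ μ ≠ 0 := by simp [Complex.cpow_eq_zero_iff]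
  have h3 : (((1 + x) / 2 : ℝ) : ℂ) ^ μ ≠ 0 := by
    simp only [ne_eq, Complex.cpow_eq_zero_iff, hpC, false_and, not_false_iff]
  rw [e3] at e2
  rw [e1, neg_div, Complex.cpow_neg, Complex.cpow_neg]
  field_simp
  linear_combination -e2

end HypergeometricSeries

theorem stmt9 (ν μ : ℂ) (h : -1 < (μ + ν).re) (x : ℝ) (hx : -1 < x) (hx1 : x < 1) :
    Summable (fun n : ℕ => ‖pochC (-2 * μ) n * pochC (-ν) n / (n.factorial : ℂ) *
        (((1 + x) / (1 - x) : ℝ) : ℂ) ^ ((n : ℂ) / 2) * ferrersP (ν - μ) (μ - n) x‖) ∧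
      ferrersP ν (-μ) x / Complex.Gamma (ν - μ + 1) =
        (2 : ℂ) ^ (-μ) * ((1 - x : ℝ) : ℂ) ^ μ / Complex.Gamma (ν + μ + 1) *
          ∑' n : ℕ, pochC (-2 * μ) n * pochC (-ν) n / (n.factorial : ℂ) *
            (((1 + x) / (1 - x) : ℝ) : ℂ) ^ ((n : ℂ) / 2) * ferrersP (ν - μ) (μ - n) x := by
  have hpre := ferrers_prefactor hx hx1 μ
  have hF := ferrersP_eq_hypTerm ν (-μ) x
  have hy0 : (((1 + x) / (1 - x) : ℝ) : ℂ) ≠ 0 := by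
    exact_mod_cast (div_pos (by linarith : 0 < 1 + x) (by linarith : 0 < 1 - x)).ne'
  have ht : ‖(((1 - x) / 2 : ℝ) : ℂ)‖ < 1 := by
    rw [Complex.norm_real, Real.norm_of_nonneg (by linarith)]
    linarith
  have hc : 0 < (1 - μ - -2 * μ - -ν).re := by
    rw [show 1 - μ - -2 * μ - -ν = 1 + (μ + ν) by ring, Complex.add_re, Complex.one_re]
    linarith
  have hT : ∀ n : ℕ, pochC (-2 * μ) n * pochC (-ν) n / (n.factorial : ℂ) *
      (((1 + x) / (1 - x) : ℝ) : ℂ) ^ ((n : ℂ) / 2) * ferrersP (ν - μ) (μ - n) x =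
      (((1 + x) / (1 - x) : ℝ) : ℂ) ^ (μ / 2) *
        ∑' k, pochC (-2 * μ) n * pochC (-ν) n / (n.factorial : ℂ) *
          (hypTerm (μ - ν) (ν - μ + 1) (1 - μ + n) k * (((1 - x) / 2 : ℝ) : ℂ) ^ k) := by
    intro n
    rw [ferrersP_eq_hypTerm, tsum_mul_left, neg_sub, show 1 - (μ - n) = 1 - μ + n by ring,
      show μ / 2 = n / 2 + (μ - n) / 2 by ring, Complex.cpow_add _ _ hy0]
    ring
  simp only [hT]
  set y : ℂ := (((1 + x) / (1 - x) : ℝ) : ℂ)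
  set t : ℂ := (((1 - x) / 2 : ℝ) : ℂ)
  have hS := summable_double_hyp (μ - ν) (ν - μ + 1) hc ht
  refine ⟨(hS.prod.mul_left _).norm, ?_⟩
  have hG : Complex.Gamma (1 + μ + ν) ≠ 0 := Complex.Gamma_ne_zero_of_re_pos (by
    rw [add_assoc, Complex.add_re, Complex.one_re]
    linarith)
  have hinner : ∀ k : ℕ, ∑' n : ℕ, pochC (-2 * μ) n * pochC (-ν) n / (n.factorial : ℂ) *
      (hypTerm (μ - ν) (ν - μ + 1) (1 - μ + n) k * t ^ k) =
      Complex.Gamma (1 + μ + ν) * (Complex.Gamma (ν - μ + 1))⁻¹ *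
        (hypTerm (μ - ν) (1 + μ + ν) (1 + μ) k * t ^ k) := by
    intro k
    have hk : 0 < (1 - μ + k - -2 * μ - -ν).re := by
      rw [show 1 - μ + k - -2 * μ - -ν = 1 - μ - -2 * μ - -ν + k by ring, Complex.add_re,
        Complex.natCast_re]
      positivity
    have hg := tsum_hypTerm hk
    rw [show 1 - μ + k - -2 * μ - -ν = 1 + μ + ν + k by ring] at hk hg
    rw [show 1 - μ + k - -2 * μ = 1 + μ + k by ring,
      show 1 - μ + k - -ν = ν - μ + 1 + k by ring] at hg
    have hGk := Complex.Gamma_ne_zero_of_re_pos hk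
    have h1 := pochC_mul_inv_Gamma (1 + μ + ν) k
    have h2 : Complex.Gamma (1 + μ + ν + k) = pochC (1 + μ + ν) k * Complex.Gamma (1 + μ + ν) := by
      field_simp at h1
      exact h1.symm
    calc _ = ∑' n, pochC (μ - ν) k * pochC (ν - μ + 1) k / k.factorial * t ^ k *
          hypTerm (-2 * μ) (-ν) (1 - μ + k) n := by
            refine tsum_congr fun n => ?_
            rw [hypTerm, hypTerm, add_right_comm]
            ring
      _ = _ := by
            rw [tsum_mul_left, hg, h2, ← pochC_mul_inv_Gamma (ν - μ + 1) k, hypTerm]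
            ring
  have hcomm := Summable.tsum_comm (f := fun n k : ℕ =>
    pochC (-2 * μ) n * pochC (-ν) n / (n.factorial : ℂ) *
      (hypTerm (μ - ν) (ν - μ + 1) (1 - μ + n) k * t ^ k)) hS
  rw [tsum_mul_left, ← hcomm, tsum_congr hinner, tsum_mul_left,
    tsum_hypTerm_euler ν μ ht, hF, hpre, sub_neg_eq_add,
    show ν + μ + 1 = 1 + μ + ν by ring]
  field_simp
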